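/- Let ψ, φ be positive normalized solutions of the Gross–Pitaevskii equation on ℝ²: −Δψ + ω² r² ψ + g ψ³ = λψ and −Δφ + ω² r² φ + g φ³ = μφ with ‖ψ‖_{L²} = ‖φ‖_{L²} = 1, ω > 0, g ≥ 0. Then ψ = φ (and λ = μ). In particular, the positive minimizer of E_B(ψ) = ∫_{ℝ²} ((1/2)|∇ψ|² + (1/2)ω²r²|ψ|² + (g/2)|ψ|⁴) on the unit L² sphere is unique and radial. -/

import Mathlib

open MeasureTheory

noncomputable section

def DxR (f : ℝ × ℝ → ℝ) : ℝ × ℝ → ℝ := fun p => fderiv ℝ f p (1, 0)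

def DyR (f : ℝ × ℝ → ℝ) : ℝ × ℝ → ℝ := fun p => fderiv ℝ f p (0, 1)

/-- Laplacian on `ℝ²`. -/
def lap (f : ℝ × ℝ → ℝ) : ℝ × ℝ → ℝ := fun p => DxR (DxR f) p + DyR (DyR f) p

/-- Cutoff functions. -/
theorem exists_cutoff : ∃ C : ℝ, ∀ R : ℝ, 0 < R → ∃ η : ℝ × ℝ → ℝ, ContDiff ℝ 1 η ∧
    HasCompactSupport η ∧ (∀ p, 0 ≤ η p) ∧ (∀ p, η p ≤ 1) ∧ (∀ p, ‖p‖ ≤ R → η p = 1) ∧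
    ∀ p v, |fderiv ℝ η p v| ≤ C / R * ‖v‖ := by
  let f : ContDiffBump (0 : ℝ × ℝ) := ⟨1, 2, by norm_num, by norm_num⟩
  have hf : ContDiff ℝ 1 f := f.contDiff
  have hfd : Continuous (fderiv ℝ f) := hf.continuous_fderiv (by norm_num)
  obtain ⟨C, hC⟩ := (f.hasCompactSupport.fderiv (𝕜 := ℝ)).exists_bound_of_continuous hfd
  refine ⟨C, fun R hR => ⟨fun p => f (R⁻¹ • p), ?_, ?_, fun p => f.nonneg, fun p => f.le_one, ?_, ?_⟩⟩
  · exact hf.comp (contDiff_const_smul _)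
  · exact f.hasCompactSupport.comp_smul (inv_ne_zero hR.ne')
  · intro p hp
    apply f.one_of_mem_closedBall
    simp only [Metric.mem_closedBall, dist_zero_right, norm_smul, norm_inv, Real.norm_eq_abs,
      abs_of_pos hR]
    change R⁻¹ * ‖p‖ ≤ 1
    rw [inv_mul_le_iff₀ hR]; linarith
  · intro p v
    have h1 : HasFDerivAt (fun p : ℝ × ℝ => f (R⁻¹ • p))
        ((fderiv ℝ f (R⁻¹ • p)).comp (R⁻¹ • ContinuousLinearMap.id ℝ (ℝ × ℝ))) p :=
      HasFDerivAt.comp (g := (f : ℝ × ℝ → ℝ)) p ((hf.differentiable (by norm_num)) _).hasFDerivAt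
        ((hasFDerivAt_id p).const_smul R⁻¹)
    rw [h1.fderiv]
    simp only [ContinuousLinearMap.comp_apply, smul_apply,
      ContinuousLinearMap.id_apply, map_smul, smul_eq_mul, abs_mul, abs_inv, abs_of_pos hR]
    have h2 := (fderiv ℝ f (R⁻¹ • p)).le_of_opNorm_le (hC _) v
    rw [Real.norm_eq_abs] at h2
    calc _ ≤ R⁻¹ * (C * ‖v‖) := by gcongr
      _ = _ := by ring

def dd (psi phi : ℝ × ℝ → ℝ) (p : ℝ × ℝ) : ℝ := max (psi p - phi p) 0

def HH (psi phi : ℝ × ℝ → ℝ) (p : ℝ × ℝ) : ℝ := dd psi phi p ^ 2 / (phi p * psi p)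

def cc (psi phi : ℝ × ℝ → ℝ) (p : ℝ × ℝ) : ℝ :=
  dd psi phi p * (psi p + phi p) / (phi p * psi p) ^ 2

def GG (psi phi : ℝ × ℝ → ℝ) (v p : ℝ × ℝ) : ℝ :=
  phi p * fderiv ℝ psi p v - psi p * fderiv ℝ phi p v

def bb (psi phi : ℝ × ℝ → ℝ) (v p : ℝ × ℝ) : ℝ :=
  HH psi phi p * (phi p * fderiv ℝ (fun q => fderiv ℝ psi q v) p v
    - psi p * fderiv ℝ (fun q => fderiv ℝ phi q v) p v)

theorem hasDerivAt_maxsq (t : ℝ) : HasDerivAt (fun s : ℝ => max s 0 ^ 2) (2 * max t 0) t := by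
  rcases lt_trichotomy t 0 with h | h | h
  · rw [max_eq_right h.le]
    have : (fun s : ℝ => max s 0 ^ 2) =ᶠ[nhds t] fun _ => 0 := by
      filter_upwards [Iio_mem_nhds h] with s hs
      rw [max_eq_right (le_of_lt hs)]; norm_num
    simpa using (hasDerivAt_const t (0 : ℝ)).congr_of_eventuallyEq this
  · subst h
    rw [hasDerivAt_iff_isLittleO]
    simp only [max_self, sub_zero, mul_zero, smul_zero, ne_eq, OfNat.ofNat_ne_zero,
      not_false_eq_true, zero_pow]
    have h1 : (fun s : ℝ => max s 0 ^ 2) =O[nhds 0] fun s : ℝ => s ^ 2 := by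
      refine Asymptotics.IsBigO.of_bound 1 (Filter.Eventually.of_forall fun s => ?_)
      rw [Real.norm_eq_abs, Real.norm_eq_abs, abs_of_nonneg (by positivity),
        abs_of_nonneg (by positivity), one_mul]
      rcases le_total s 0 with h | h
      · rw [max_eq_right h]; nlinarith [sq_nonneg s]
      · rw [max_eq_left h]
    refine h1.trans_isLittleO ?_
    exact Asymptotics.isLittleO_pow_id (by norm_num)
  · rw [max_eq_left h.le]
    have : (fun s : ℝ => max s 0 ^ 2) =ᶠ[nhds t] fun s => s ^ 2 := by
      filter_upwards [Ioi_mem_nhds h] with s hs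
      rw [max_eq_left (le_of_lt hs)]
    simpa using (hasDerivAt_pow 2 t).congr_of_eventuallyEq this

section
variable {psi phi : ℝ × ℝ → ℝ}

theorem dd_cases (p : ℝ × ℝ) : (dd psi phi p = 0 ∧ psi p ≤ phi p) ∨
    (dd psi phi p = psi p - phi p ∧ phi p < psi p) := by
  rcases le_or_gt (psi p) (phi p) with h | h
  · exact Or.inl ⟨max_eq_right (by linarith), h⟩
  · exact Or.inr ⟨max_eq_left (by linarith), h⟩

theorem dd_nonneg (p : ℝ × ℝ) : 0 ≤ dd psi phi p := le_max_right _ _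

theorem HH_hasFDerivAt (hpsi : Differentiable ℝ psi) (hphi : Differentiable ℝ phi)
    (hpsi_pos : ∀ p, 0 < psi p) (hphi_pos : ∀ p, 0 < phi p) (p : ℝ × ℝ) :
    ∃ L : ℝ × ℝ →L[ℝ] ℝ, HasFDerivAt (HH psi phi) L p ∧
      ∀ v, L v = cc psi phi p * GG psi phi v p := by
  have h1 := (hpsi p).hasFDerivAt
  have h2 := (hphi p).hasFDerivAt
  have a := hpsi_pos p
  have b := hphi_pos p
  have h3 := (hasDerivAt_maxsq (psi p - phi p)).comp_hasFDerivAt p (h1.sub h2)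
  have h4 := h3.mul ((hasDerivAt_inv (mul_pos b a).ne').comp_hasFDerivAt p (h2.mul h1))
  refine ⟨_, h4, fun v => ?_⟩
  simp only [cc, GG, Function.comp_apply, add_apply,
    smul_apply, sub_apply, smul_eq_mul]
  have : max (psi p - phi p) 0 = dd psi phi p := rfl
  simp only [Pi.mul_apply, Pi.sub_apply, this]
  rcases dd_cases (psi := psi) (phi := phi) p with ⟨h, _⟩ | ⟨h, _⟩
  · rw [h]; ring
  · rw [h]; field_simp; ring

theorem energy_dir (hpsi : ContDiff ℝ 2 psi) (hphi : ContDiff ℝ 2 phi)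
    (hpsi_pos : ∀ p, 0 < psi p) (hphi_pos : ∀ p, 0 < phi p)
    (hint : Integrable (fun p => psi p ^ 2)) (hnorm : ∫ p, psi p ^ 2 = 1)
    (η : ℝ × ℝ → ℝ) (hη : ContDiff ℝ 1 η) (hc : HasCompactSupport η)
    (v : ℝ × ℝ) (M : ℝ) (hM : ∀ p, |fderiv ℝ η p v| ≤ M) :
    Continuous (fun p => cc psi phi p * GG psi phi v p ^ 2) ∧ Continuous (bb psi phi v) ∧
    ∫ p, η p ^ 2 * (cc psi phi p * GG psi phi v p ^ 2 / 2 + bb psi phi v p) ≤ 2 * M ^ 2 := by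
  have cpsi : Continuous psi := hpsi.continuous
  have cphi : Continuous phi := hphi.continuous
  have cη : Continuous η := hη.continuous
  have dpsi : Differentiable ℝ psi := hpsi.differentiable (by norm_num)
  have dphi : Differentiable ℝ phi := hphi.differentiable (by norm_num)
  have dη : Differentiable ℝ η := hη.differentiable (by norm_num)
  have hne : ∀ p, phi p * psi p ≠ 0 := fun p => (mul_pos (hphi_pos p) (hpsi_pos p)).ne'
  have s1 : ContDiff ℝ 1 (fun q => fderiv ℝ psi q v) :=
    (hpsi.fderiv_right (m := 1) (by norm_num)).clm_apply contDiff_const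
  have s2 : ContDiff ℝ 1 (fun q => fderiv ℝ phi q v) :=
    (hphi.fderiv_right (m := 1) (by norm_num)).clm_apply contDiff_const
  have c1 := s1.continuous
  have c2 := s2.continuous
  have c11 : Continuous (fun p => fderiv ℝ (fun q => fderiv ℝ psi q v) p v) :=
    (s1.continuous_fderiv (by norm_num)).clm_apply continuous_const
  have c22 : Continuous (fun p => fderiv ℝ (fun q => fderiv ℝ phi q v) p v) :=
    (s2.continuous_fderiv (by norm_num)).clm_apply continuous_const
  have cηv : Continuous (fun p => fderiv ℝ η p v) :=
    (hη.continuous_fderiv (by norm_num)).clm_apply continuous_const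
  have cdd : Continuous (dd psi phi) := (cpsi.sub cphi).max continuous_const
  have cHH : Continuous (HH psi phi) := (cdd.pow 2).div (cphi.mul cpsi) hne
  have ccc : Continuous (cc psi phi) :=
    (cdd.mul (cpsi.add cphi)).div ((cphi.mul cpsi).pow 2) (fun p => pow_ne_zero 2 (hne p))
  have cGG : Continuous (GG psi phi v) := (cphi.mul c1).sub (cpsi.mul c2)
  have ca : Continuous (fun p => cc psi phi p * GG psi phi v p ^ 2) := ccc.mul (cGG.pow 2)
  have cb : Continuous (bb psi phi v) := cHH.mul ((cphi.mul c11).sub (cpsi.mul c22))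
  refine ⟨ca, cb, ?_⟩
  -- the field
  let F : ℝ × ℝ → ℝ := fun p => HH psi phi p * GG psi phi v p
  have hF : ∀ p, DifferentiableAt ℝ F p ∧
      fderiv ℝ F p v = cc psi phi p * GG psi phi v p ^ 2 + bb psi phi v p := by
    intro p
    obtain ⟨L, hL, hLv⟩ := HH_hasFDerivAt dpsi dphi hpsi_pos hphi_pos p
    have g1 := (dphi p).hasFDerivAt.mul ((s1.differentiable (by norm_num)) p).hasFDerivAt
    have g2 := (dpsi p).hasFDerivAt.mul ((s2.differentiable (by norm_num)) p).hasFDerivAt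
    have g3 : HasFDerivAt (GG psi phi v) _ p := g1.sub g2
    have g4 : HasFDerivAt F _ p := hL.mul g3
    refine ⟨g4.differentiableAt, ?_⟩
    rw [g4.fderiv]
    simp only [add_apply, smul_apply,
      sub_apply, smul_eq_mul, hLv, bb]
    ring
  have hη2 : ∀ p, HasFDerivAt (fun q => η q ^ 2) ((2 * η p) • fderiv ℝ η p) p := by
    intro p
    have := (dη p).hasFDerivAt.pow 2
    simpa using this
  have hη2v : ∀ p, fderiv ℝ (fun q => η q ^ 2) p v = 2 * η p * fderiv ℝ η p v := by
    intro p; rw [(hη2 p).fderiv]; simp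
  have cF : Continuous F := cHH.mul cGG
  have icc : ∀ f : ℝ × ℝ → ℝ, Continuous f → Integrable (fun p => η p * f p) := fun f hf =>
    (cη.mul hf).integrable_of_hasCompactSupport hc.mul_right
  have i1 : Integrable (fun p => η p ^ 2 * (cc psi phi p * GG psi phi v p ^ 2 + bb psi phi v p)) := by
    have := icc _ (cη.mul (ca.add cb))
    refine this.congr (Filter.Eventually.of_forall fun p => ?_)
    simp only [Pi.mul_apply, Pi.add_apply]; ring
  have i2 : Integrable (fun p => F p * (2 * η p * fderiv ℝ η p v)) := by
    have := icc _ ((cF.mul cηv).mul (continuous_const (y := (2 : ℝ))))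
    refine this.congr (Filter.Eventually.of_forall fun p => ?_)
    simp only [Pi.mul_apply, Pi.add_apply]; ring
  have i3 : Integrable (fun p => η p ^ 2 * (cc psi phi p * GG psi phi v p ^ 2 / 2)) := by
    have := icc _ (cη.mul (ca.div_const 2))
    refine this.congr (Filter.Eventually.of_forall fun p => ?_)
    simp only [Pi.mul_apply, Pi.add_apply]; ring
  have i4 : Integrable (fun p => F p * η p ^ 2) := by
    have := icc _ (cF.mul cη)
    refine this.congr (Filter.Eventually.of_forall fun p => ?_)
    simp only [Pi.mul_apply, Pi.add_apply]; ring
  have ibp : ∫ p, F p * (2 * η p * fderiv ℝ η p v) =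
      - ∫ p, η p ^ 2 * (cc psi phi p * GG psi phi v p ^ 2 + bb psi phi v p) := by
    have := integral_mul_fderiv_eq_neg_fderiv_mul_of_integrable (μ := (volume : Measure (ℝ × ℝ)))
      (f := F) (g := fun q => η q ^ 2) (v := v) ?_ ?_ i4 (fun p _ => (hF p).1)
      (fun p _ => (hη2 p).differentiableAt)
    · simp only [hη2v, (hF _).2] at this
      rw [this]; congr 2; funext p; ring
    · refine i1.congr (Filter.Eventually.of_forall fun p => ?_)
      simp only [(hF p).2]; ring
    · simpa only [hη2v] using i2
  -- pointwise estimate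
  have pw : ∀ p, η p ^ 2 * (cc psi phi p * GG psi phi v p ^ 2 / 2 + bb psi phi v p) ≤
      (η p ^ 2 * (cc psi phi p * GG psi phi v p ^ 2 + bb psi phi v p)
        + F p * (2 * η p * fderiv ℝ η p v)) + 2 * M ^ 2 * psi p ^ 2 := by
    intro p
    have a := hpsi_pos p
    have b := hphi_pos p
    have hm : fderiv ℝ η p v ^ 2 ≤ M ^ 2 := sq_le_sq' (by linarith [(abs_le.1 (hM p)).1]) (abs_le.1 (hM p)).2
    have key : 0 ≤ η p ^ 2 * (cc psi phi p * GG psi phi v p ^ 2) / 2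
        + F p * (2 * η p * fderiv ℝ η p v) + 2 * fderiv ℝ η p v ^ 2 * psi p ^ 2 := by
      simp only [F, HH, cc]
      generalize fderiv ℝ η p v = e
      generalize GG psi phi v p = G
      generalize η p = t
      rcases dd_cases (psi := psi) (phi := phi) p with ⟨h, _⟩ | ⟨h, hlt⟩
      · rw [h]; simp; positivity
      · rw [h]
        generalize psi p = x at *
        generalize phi p = y at *
        have hd : 0 < x - y := by linarith
        have hle : (x - y) ^ 3 / (x + y) ≤ x ^ 2 := by
          rw [div_le_iff₀ (by linarith)]
          nlinarith [mul_pos a b, mul_pos (mul_pos a a) b, mul_pos (mul_pos a b) b, pow_pos b 3, mul_pos (mul_pos a b) hd]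
        have e1 : t ^ 2 * ((x - y) * (x + y) / (y * x) ^ 2 * G ^ 2) / 2
            + (x - y) ^ 2 / (y * x) * G * (2 * t * e) + 2 * e ^ 2 * ((x - y) ^ 3 / (x + y))
            = (x - y) / (2 * (x + y)) * (t * G * (x + y) / (y * x) + 2 * e * (x - y)) ^ 2 := by
          field_simp; ring
        have e2 : 0 ≤ (x - y) / (2 * (x + y)) * (t * G * (x + y) / (y * x) + 2 * e * (x - y)) ^ 2 := by
          positivity
        nlinarith [mul_le_mul_of_nonneg_left hle (sq_nonneg e)]
    nlinarith [mul_le_mul_of_nonneg_right hm (sq_nonneg (psi p))]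
  calc _ ≤ ∫ p, ((η p ^ 2 * (cc psi phi p * GG psi phi v p ^ 2 + bb psi phi v p)
        + F p * (2 * η p * fderiv ℝ η p v)) + 2 * M ^ 2 * psi p ^ 2) := by
        refine integral_mono ?_ ((i1.add i2).add (hint.const_mul _)) pw
        refine (i1.sub i3).congr (Filter.Eventually.of_forall fun p => ?_)
        simp only [Pi.sub_apply]; ring
    _ = 2 * M ^ 2 := by
        have j1 := integral_add (i1.add i2) (hint.const_mul (2 * M ^ 2))
        have j2 := integral_add i1 i2
        simp only [Pi.add_apply] at j1
        rw [j1, j2, ibp, integral_const_mul, hnorm]; ring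

end

theorem psi_eq_of_le
    (omega g lam mu : ℝ) (hg : 0 ≤ g) (hle : lam ≤ mu)
    (psi phi : ℝ × ℝ → ℝ)
    (hpsi_smooth : ContDiff ℝ 2 psi) (hphi_smooth : ContDiff ℝ 2 phi)
    (hpsi_pos : ∀ p, 0 < psi p) (hphi_pos : ∀ p, 0 < phi p)
    (hpsi_norm : (∫ p : ℝ × ℝ, psi p ^ 2) = 1)
    (hphi_norm : (∫ p : ℝ × ℝ, phi p ^ 2) = 1)
    (hpsi_eq : ∀ p : ℝ × ℝ,
      -lap psi p + omega ^ 2 * (p.1 ^ 2 + p.2 ^ 2) * psi p + g * psi p ^ 3 = lam * psi p)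
    (hphi_eq : ∀ p : ℝ × ℝ,
      -lap phi p + omega ^ 2 * (p.1 ^ 2 + p.2 ^ 2) * phi p + g * phi p ^ 3 = mu * phi p) :
    psi = phi := by
  have ipsi : Integrable (fun p => psi p ^ 2) := by
    by_contra h; rw [integral_undef h] at hpsi_norm; norm_num at hpsi_norm
  have iphi : Integrable (fun p => phi p ^ 2) := by
    by_contra h; rw [integral_undef h] at hphi_norm; norm_num at hphi_norm
  have cpsi : Continuous psi := hpsi_smooth.continuous
  have cphi : Continuous phi := hphi_smooth.continuous
  have hcc : ∀ p, 0 ≤ cc psi phi p := fun p => by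
    have := hpsi_pos p; have := hphi_pos p
    have := dd_nonneg (psi := psi) (phi := phi) p
    unfold cc; positivity
  have hbb : ∀ p, 0 ≤ bb psi phi (1, 0) p + bb psi phi (0, 1) p := by
    intro p
    have a := hpsi_pos p
    have b := hphi_pos p
    have e : bb psi phi (1, 0) p + bb psi phi (0, 1) p
        = HH psi phi p * (phi p * lap psi p - psi p * lap phi p) := by
      have l1 : lap psi p = fderiv ℝ (fun q => fderiv ℝ psi q (1, 0)) p (1, 0)
        + fderiv ℝ (fun q => fderiv ℝ psi q (0, 1)) p (0, 1) := rfl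
      have l2 : lap phi p = fderiv ℝ (fun q => fderiv ℝ phi q (1, 0)) p (1, 0)
        + fderiv ℝ (fun q => fderiv ℝ phi q (0, 1)) p (0, 1) := rfl
      rw [l1, l2]; simp only [bb]; ring
    have e1 : phi p * lap psi p - psi p * lap phi p
        = phi p * psi p * (g * (psi p ^ 2 - phi p ^ 2) + (mu - lam)) := by
      linear_combination (-phi p) * hpsi_eq p + psi p * hphi_eq p
    rw [e, e1]
    rcases dd_cases (psi := psi) (phi := phi) p with ⟨h, _⟩ | ⟨h, hlt⟩
    · simp [HH, h]
    · have h1 : 0 ≤ psi p ^ 2 - phi p ^ 2 := by nlinarith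
      have h2 : 0 ≤ mu - lam := by linarith
      unfold HH
      positivity
  obtain ⟨C, hC⟩ := exists_cutoff
  let K : ℝ × ℝ → ℝ := fun p =>
    (cc psi phi p * GG psi phi (1, 0) p ^ 2 / 2 + bb psi phi (1, 0) p) +
    (cc psi phi p * GG psi phi (0, 1) p ^ 2 / 2 + bb psi phi (0, 1) p)
  have hK0 : ∀ p, 0 ≤ K p := fun p => by
    have h1 := mul_nonneg (hcc p) (sq_nonneg (GG psi phi (1, 0) p))
    have h2 := mul_nonneg (hcc p) (sq_nonneg (GG psi phi (0, 1) p))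
    have := hbb p
    simp only [K]; linarith
  have hKR : ∀ R > 0, ∀ η : ℝ × ℝ → ℝ, ContDiff ℝ 1 η → HasCompactSupport η →
      (∀ p v, |fderiv ℝ η p v| ≤ C / R * ‖v‖) →
      Continuous K ∧ ∫ p, η p ^ 2 * K p ≤ 4 * (C / R) ^ 2 := by
    intro R hR η h1 h2 h3
    obtain ⟨a1, b1, l1⟩ := energy_dir hpsi_smooth hphi_smooth hpsi_pos hphi_pos ipsi hpsi_norm
      η h1 h2 (1, 0) (C / R) (fun p => by simpa using h3 p (1, 0))
    obtain ⟨a2, b2, l2⟩ := energy_dir hpsi_smooth hphi_smooth hpsi_pos hphi_pos ipsi hpsi_norm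
      η h1 h2 (0, 1) (C / R) (fun p => by simpa using h3 p (0, 1))
    have k1 := (a1.div_const 2).add b1
    have k2 := (a2.div_const 2).add b2
    have icc : ∀ f : ℝ × ℝ → ℝ, Continuous f → Integrable (fun p => η p ^ 2 * f p) := by
      intro f hf
      have : Integrable (fun p => η p * (η p * f p)) :=
        (h1.continuous.mul (h1.continuous.mul hf)).integrable_of_hasCompactSupport h2.mul_right
      refine this.congr (Filter.Eventually.of_forall fun p => ?_)
      simp only [Pi.mul_apply, Pi.add_apply]; ring
    refine ⟨k1.add k2, ?_⟩
    have j := integral_add (icc _ k1) (icc _ k2)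
    simp only [Pi.add_apply, ← mul_add (_ ^ 2) (_ + _) (_ + _)] at j
    change ∫ p, η p ^ 2 * K p = _ at j
    rw [j]
    linarith
  have hK : ∀ p, K p = 0 := by
    intro p
    by_contra hne
    let R0 := ‖p‖ + 1
    have hR0 : 0 < R0 := by positivity
    obtain ⟨η, e1, e2, e3, e4, e5, e6⟩ := hC R0 hR0
    obtain ⟨cK, -⟩ := hKR R0 hR0 η e1 e2 e6
    have cI : Continuous (fun p => η p ^ 2 * K p) := (e1.continuous.pow 2).mul cK
    have sI : ∀ η : ℝ × ℝ → ℝ, HasCompactSupport η → HasCompactSupport (fun p => η p ^ 2 * K p) := by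
      intro η h
      have : HasCompactSupport (fun p => η p * (η p * K p)) := h.mul_right
      convert this using 2; ring
    have hpos : 0 < ∫ p, η p ^ 2 * K p := by
      refine cI.integral_pos_of_hasCompactSupport_nonneg_nonzero (x := p) (sI η e2)
        (fun q => mul_nonneg (sq_nonneg _) (hK0 q)) ?_
      rw [e5 p (by simp [R0])]; simpa using hne
    have hcomp : IsCompact (tsupport η) := e2
    obtain ⟨S, hS⟩ := hcomp.isBounded.exists_norm_le
    have hb : ∀ R > 0, S ≤ R → ∫ p, η p ^ 2 * K p ≤ 4 * (C / R) ^ 2 := by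
      intro R hR hSR
      obtain ⟨ζ, f1, f2, f3, f4, f5, f6⟩ := hC R hR
      refine le_trans (integral_mono (cI.integrable_of_hasCompactSupport (sI η e2))
        (((f1.continuous.pow 2).mul cK).integrable_of_hasCompactSupport (sI ζ f2)) ?_)
        (hKR R hR ζ f1 f2 f6).2
      intro q
      refine mul_le_mul_of_nonneg_right ?_ (hK0 q)
      change η q ^ 2 ≤ ζ q ^ 2
      by_cases hq : q ∈ tsupport η
      · rw [f5 q ((hS q hq).trans hSR)]
        have := e3 q; have := e4 q; nlinarith
      · rw [image_eq_zero_of_notMem_tsupport hq]; simp only [ne_eq, OfNat.ofNat_ne_zero,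
          not_false_eq_true, zero_pow]; positivity
    have hlim : Filter.Tendsto (fun R : ℝ => 4 * (C / R) ^ 2) Filter.atTop (nhds 0) := by
      have := ((Filter.Tendsto.const_div_atTop (Filter.tendsto_id (α := ℝ)) C).pow 2).const_mul 4
      simpa using this
    have := ge_of_tendsto hlim (b := ∫ p, η p ^ 2 * K p) (by
      filter_upwards [Filter.eventually_gt_atTop 0, Filter.eventually_ge_atTop S] with R h1 h2
      exact hb R h1 h2)
    linarith
  have hL : ∀ p, HasFDerivAt (HH psi phi) (0 : ℝ × ℝ →L[ℝ] ℝ) p := by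
    intro p
    obtain ⟨L, hL, hLv⟩ := HH_hasFDerivAt (hpsi_smooth.differentiable (by norm_num))
      (hphi_smooth.differentiable (by norm_num)) hpsi_pos hphi_pos p
    have h1 := mul_nonneg (hcc p) (sq_nonneg (GG psi phi (1, 0) p))
    have h2 := mul_nonneg (hcc p) (sq_nonneg (GG psi phi (0, 1) p))
    have h3 := hbb p
    have h4 := hK p
    simp only [K] at h4
    have z1 : cc psi phi p * GG psi phi (1, 0) p ^ 2 = 0 := by linarith
    have z2 : cc psi phi p * GG psi phi (0, 1) p ^ 2 = 0 := by linarith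
    have y1 : L (1, 0) = 0 := by rw [hLv]; simpa using z1
    have y2 : L (0, 1) = 0 := by rw [hLv]; simpa using z2
    have : L = 0 := by
      ext <;> simp [y1, y2]
    rwa [this] at hL
  have hconst : ∀ p, HH psi phi p = HH psi phi 0 := fun p =>
    is_const_of_fderiv_eq_zero (𝕜 := ℝ) (fun q => (hL q).differentiableAt)
      (fun q => (hL q).fderiv) p 0
  have hsub : ∫ p, (psi p ^ 2 - phi p ^ 2) = 0 := by
    rw [integral_sub ipsi iphi, hpsi_norm, hphi_norm, sub_self]
  have hcont : Continuous (fun p => psi p ^ 2 - phi p ^ 2) := (cpsi.pow 2).sub (cphi.pow 2)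
  by_cases h0 : HH psi phi 0 = 0
  · have hle' : ∀ p, psi p ≤ phi p := by
      intro p
      rcases dd_cases (psi := psi) (phi := phi) p with ⟨_, h⟩ | ⟨h, hlt⟩
      · exact h
      · exfalso
        have h1 := (hconst p).trans h0
        have : 0 < HH psi phi p := by
          have := hpsi_pos p; have := hphi_pos p
          have : 0 < psi p - phi p := by linarith
          unfold HH; rw [h]; positivity
        linarith
    funext p
    by_contra hne
    have hlt := lt_of_le_of_ne (hle' p) hne
    have := integral_pos_of_integrable_nonneg_nonzero (μ := volume) (x := p)
      (f := fun q => -(psi q ^ 2 - phi q ^ 2)) hcont.neg (ipsi.sub iphi).neg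
      (fun q => by
        have := hle' q; have := hpsi_pos q
        simp only [Pi.zero_apply]; nlinarith)
      (by have := hpsi_pos p; nlinarith)
    rw [integral_neg, hsub] at this
    linarith
  · exfalso
    have hlt : ∀ p, phi p < psi p := by
      intro p
      rcases dd_cases (psi := psi) (phi := phi) p with ⟨h, _⟩ | ⟨_, h⟩
      · exact absurd (by rw [← hconst p]; simp [HH, h]) h0
      · exact h
    have := integral_pos_of_integrable_nonneg_nonzero (μ := volume) (x := 0) hcont
      (ipsi.sub iphi)
      (fun q => by
        have := hlt q; have := hphi_pos q
        simp only [Pi.zero_apply]; nlinarith)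
      (by have := hphi_pos 0; have := hlt 0; nlinarith)
    rw [hsub] at this
    linarith

theorem gp_positive_solution_unique
    (omega g lam mu : ℝ) (homega : 0 < omega) (hg : 0 ≤ g)
    (psi phi : ℝ × ℝ → ℝ)
    (hpsi_smooth : ContDiff ℝ 2 psi) (hphi_smooth : ContDiff ℝ 2 phi)
    (hpsi_pos : ∀ p, 0 < psi p) (hphi_pos : ∀ p, 0 < phi p)
    (hpsi_norm : (∫ p : ℝ × ℝ, psi p ^ 2) = 1)
    (hphi_norm : (∫ p : ℝ × ℝ, phi p ^ 2) = 1)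
    (hpsi_eq : ∀ p : ℝ × ℝ,
      -lap psi p + omega ^ 2 * (p.1 ^ 2 + p.2 ^ 2) * psi p + g * psi p ^ 3 = lam * psi p)
    (hphi_eq : ∀ p : ℝ × ℝ,
      -lap phi p + omega ^ 2 * (p.1 ^ 2 + p.2 ^ 2) * phi p + g * phi p ^ 3 = mu * phi p) :
    psi = phi ∧ lam = mu := by
  have hmain : psi = phi := by
    rcases le_total lam mu with h | h
    · exact psi_eq_of_le omega g lam mu hg h psi phi hpsi_smooth hphi_smooth hpsi_pos hphi_pos
        hpsi_norm hphi_norm hpsi_eq hphi_eq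
    · exact (psi_eq_of_le omega g mu lam hg h phi psi hphi_smooth hpsi_smooth hphi_pos hpsi_pos
        hphi_norm hpsi_norm hphi_eq hpsi_eq).symm
  refine ⟨hmain, ?_⟩
  subst hmain
  have h := (hpsi_eq 0).symm.trans (hphi_eq 0)
  exact mul_right_cancel₀ (hpsi_pos 0).ne' h

end
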